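/- For h ≥ 3, the h-th graded component of the odd Hamiltonian superalgebra satisfies HO_h = M(HO)_h + Σ 𝔽·T_H(x^(α) x^u), where M(HO) = [HO⁺, HO⁺] (with HO⁺ = ⊕_{i≥1} HO_i) and the sum runs over α ∈ 𝔸(n; t̲), u ∈ 𝔹(n) with |α| + |u| − 2 = h and α_i ≡ 0 or 1 (mod p) for every i ∈ {1,…,n}. -/

import Mathlib

open scoped Classical
noncomputable section

/-- The sign `(-1)^a` for a parity `a : ZMod 2`. -/
def sgn (F : Type*) [Ring F] (a : ZMod 2) : F := if a = 0 then 1 else -1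

/-- Index of a monomial `x^(α) x^u` of `𝒪(n, n'; t̲)`: a divided power exponent
`α : Fin n → ℕ` for the even variables and a subset `u` of the `n'` odd
variables. -/
abbrev SIdx (n n' : ℕ) : Type := (Fin n → ℕ) × Finset (Fin n')

/-- The superalgebra `𝒪(n, n'; t̲)` (divided powers ⊗ exterior algebra), as the
free module on the monomials (monomials with an exponent out of range multiply
to zero automatically in characteristic `p`). -/
abbrev SAlg (F : Type*) [Field F] (n n' : ℕ) : Type _ := SIdx n n' →₀ F

variable {F : Type*} [Field F] {n n' : ℕ}

/-- The Koszul sign produced when multiplying `x^u · x^v`. -/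
def mulSign (F : Type*) [Field F] {n' : ℕ} (u v : Finset (Fin n')) : F :=
  (-1 : F) ^ ((u ×ˢ v).filter fun q => q.2 < q.1).card

/-- Product of two monomials: `x^(α)x^u · x^(β)x^v = ± C(α+β, α) x^(α+β) x^{u∪v}`
if `u ∩ v = ∅`, and `0` otherwise. -/
def sMulB (q r : SIdx n n') : SAlg F n n' :=
  if Disjoint q.2 r.2 then
    (mulSign F q.2 r.2 * ∏ i, ((q.1 i + r.1 i).choose (q.1 i) : F)) •
      Finsupp.single (fun i => q.1 i + r.1 i, q.2 ∪ r.2) (1 : F)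
  else 0

/-- The (super-commutative) multiplication of `𝒪(n, n'; t̲)`. -/
def sMul (f g : SAlg F n n') : SAlg F n n' :=
  f.sum fun q c => g.sum fun r d => (c * d) • sMulB q r

/-- The even partial derivative `∂_i`, `i ∈ {1, …, n}`: `∂_i(x^(α)) = x^(α-ε_i)`. -/
def De (i : Fin n) (f : SAlg F n n') : SAlg F n n' :=
  f.sum fun q c =>
    if 0 < q.1 i then Finsupp.single (Function.update q.1 i (q.1 i - 1), q.2) c
    else 0

/-- The odd partial derivative `∂_j` with respect to the `j`-th odd variable. -/
def Do (j : Fin n') (f : SAlg F n n') : SAlg F n n' :=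
  f.sum fun q c =>
    if j ∈ q.2 then
      ((-1 : F) ^ (q.2.filter fun k => k < j).card * c) •
        Finsupp.single (q.1, q.2.erase j) (1 : F)
    else 0

/-- `f` is ℤ₂-homogeneous of parity `c`. -/
def IsHomog (c : ZMod 2) (f : SAlg F n n') : Prop :=
  ∀ q ∈ f.support, ((q.2.card : ZMod 2) = c)

/-- All exponents appearing in `f` are bounded by `π_i = p^{t_i} - 1`, i.e. `f`
lies in the truncated algebra `𝒪(n, n'; t̲)`. -/
def Bounded (p : ℕ) (t : Fin n → ℕ) (f : SAlg F n n') : Prop :=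
  ∀ q ∈ f.support, ∀ i, Prod.fst q i ≤ p ^ t i - 1

/-- `T_H(a)`, for `a` homogeneous of parity `pa`, as an operator on
`𝒪(n, n; t̲)`:  `T_H(a) = Σ_{i=1}^{2n} (-1)^{p(∂_i) p(a)} ∂_i(a) ∂_{i'}`. -/
def TH (pa : ZMod 2) (a b : SAlg F n n) : SAlg F n n :=
  (∑ i : Fin n, sMul (De i a) (Do i b)) +
    sgn F pa • ∑ i : Fin n, sMul (Do i a) (De i b)


variable (F)

/-- The operator `T_H(x^(α)x^u)` attached to a monomial `q = (α, u)`. -/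
def THm (q : SIdx n n) : SAlg F n n → SAlg F n n :=
  TH ((q.2.card : ZMod 2)) (Finsupp.single q (1 : F))

/-- The graded component `HO_h` (operators of monomial degree `h + 2`). -/
def HOcomp (p : ℕ) (t : Fin n → ℕ) (h : ℕ) :
    Submodule F (SAlg F n n → SAlg F n n) :=
  Submodule.span F {g | ∃ q : SIdx n n, (∀ i, q.1 i ≤ p ^ t i - 1) ∧
    (∑ i, q.1 i) + q.2.card = h + 2 ∧ g = THm F q}

/-- The graded component `M(HO)_h` of `M(HO) = [HO⁺, HO⁺]`: the span of
supercommutators of monomial operators of positive degrees summing to `h`. -/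
def Mcomp (p : ℕ) (t : Fin n → ℕ) (h : ℕ) :
    Submodule F (SAlg F n n → SAlg F n n) :=
  Submodule.span F {g | ∃ q r : SIdx n n,
    (∀ i, q.1 i ≤ p ^ t i - 1) ∧ (∀ i, r.1 i ≤ p ^ t i - 1) ∧
    3 ≤ (∑ i, q.1 i) + q.2.card ∧ 3 ≤ (∑ i, r.1 i) + r.2.card ∧
    ((∑ i, q.1 i) + q.2.card - 2) + ((∑ i, r.1 i) + r.2.card - 2) = h ∧
    g = fun x => THm F q (THm F r x) -
      sgn F (((q.2.card : ZMod 2) + 1) * ((r.2.card : ZMod 2) + 1)) •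
        THm F r (THm F q x)}

/-- The span of the `T_H(x^(α)x^u)` of degree `h` with every `α_i ≡ 0, 1 (mod p)`. -/
def Acomp (p : ℕ) (t : Fin n → ℕ) (h : ℕ) :
    Submodule F (SAlg F n n → SAlg F n n) :=
  Submodule.span F {g | ∃ q : SIdx n n, (∀ i, q.1 i ≤ p ^ t i - 1) ∧
    (∑ i, q.1 i) + q.2.card = h + 2 ∧
    (∀ i, q.1 i % p = 0 ∨ q.1 i % p = 1) ∧ g = THm F q}


variable {F}

lemma sgn_zero : sgn F 0 = 1 := by simp [sgn]

lemma sgn_one : sgn F 1 = -1 := by simp [sgn]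

lemma zmod_two_cases (a : ZMod 2) : a = 0 ∨ a = 1 := by
  revert a; decide

lemma sgn_add (a b : ZMod 2) : sgn F (a + b) = sgn F a * sgn F b := by
  have h2 : (1 + 1 : ZMod 2) = 0 := by decide
  rcases zmod_two_cases a with rfl | rfl <;> rcases zmod_two_cases b with rfl | rfl <;>
    simp [sgn_zero, sgn_one, h2]

lemma sgn_natCast (k : ℕ) : sgn F (k : ZMod 2) = (-1) ^ k := by
  induction k with
  | zero => simp [sgn_zero]
  | succ k ih => rw [Nat.cast_succ, sgn_add, ih, sgn_one, pow_succ]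

/-! ### Signs of products of odd monomials -/

lemma mulSign_union_right (u : Finset (Fin n')) {v w : Finset (Fin n')} (h : Disjoint v w) :
    mulSign F u (v ∪ w) = mulSign F u v * mulSign F u w := by
  unfold mulSign
  rw [← pow_add, Finset.product_union, Finset.filter_union, Finset.card_union_of_disjoint]
  exact Finset.disjoint_filter_filter (Finset.disjoint_product.2 (Or.inr h))

lemma mulSign_union_left {u v : Finset (Fin n')} (w : Finset (Fin n')) (h : Disjoint u v) :
    mulSign F (u ∪ v) w = mulSign F u w * mulSign F v w := by
  unfold mulSign
  rw [← pow_add, Finset.union_product, Finset.filter_union, Finset.card_union_of_disjoint]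
  exact Finset.disjoint_filter_filter (Finset.disjoint_product.2 (Or.inl h))

lemma mulSign_empty_left (v : Finset (Fin n')) : mulSign F ∅ v = 1 := by simp [mulSign]

lemma mulSign_empty_right (u : Finset (Fin n')) : mulSign F u ∅ = 1 := by simp [mulSign]

lemma mulSign_mul_self (u v : Finset (Fin n')) : mulSign F u v * mulSign F u v = 1 := by
  unfold mulSign
  rw [← mul_pow]; simp

lemma mulSign_swap {u v : Finset (Fin n')} (h : Disjoint u v) :
    mulSign F u v * mulSign F v u = (-1) ^ (u.card * v.card) := by
  unfold mulSign
  rw [← pow_add, ← Finset.card_product]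
  have h1 : ((v ×ˢ u).filter fun q => q.2 < q.1).card =
      ((u ×ˢ v).filter fun q => ¬ q.2 < q.1).card := by
    refine Finset.card_bij' (fun q _ => q.swap) (fun q _ => q.swap) ?_ ?_ ?_ ?_
    · rintro ⟨a, b⟩ hq
      simp only [Finset.mem_filter, Finset.mem_product, Prod.swap, not_lt] at hq ⊢
      exact ⟨hq.1.symm, hq.2.le⟩
    · rintro ⟨a, b⟩ hq
      simp only [Finset.mem_filter, Finset.mem_product, Prod.swap, not_lt] at hq ⊢
      exact ⟨hq.1.symm, lt_of_le_of_ne hq.2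
        fun hab => Finset.disjoint_left.1 h hq.1.1 (hab ▸ hq.1.2)⟩
    · simp
    · simp
  rw [h1, Finset.card_filter_add_card_filter_not]

lemma mulSign_comm {u v : Finset (Fin n')} (h : Disjoint u v) :
    mulSign F u v = (-1) ^ (u.card * v.card) * mulSign F v u := by
  rw [← mulSign_swap h, mul_assoc, mulSign_mul_self, mul_one]

lemma neg_one_pow_filter_lt (j : Fin n') (u : Finset (Fin n')) :
    (-1 : F) ^ (u.filter fun k => k < j).card = mulSign F {j} (u.erase j) := by
  unfold mulSign
  congr 1
  refine Finset.card_bij (fun k _ => (j, k)) ?_ ?_ ?_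
  · intro k hk
    simp only [Finset.mem_filter] at hk
    simp [hk.1, hk.2, hk.2.ne]
  · simp
  · rintro ⟨a, b⟩ hq
    simp only [Finset.mem_filter, Finset.mem_product, Finset.mem_singleton, Finset.mem_erase] at hq
    obtain ⟨⟨rfl, _, hb⟩, hlt⟩ := hq
    exact ⟨b, by simp [hb, hlt], rfl⟩

/-! ### The multiplication and the partial derivatives as linear maps -/

/-- The multiplication of `𝒪(n, n'; t̲)` as a bilinear map. -/
def mulL : SAlg F n n' →ₗ[F] SAlg F n n' →ₗ[F] SAlg F n n' :=
  LinearMap.mk₂ F sMul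
    (fun f f' g => by
      unfold sMul
      rw [Finsupp.sum_add_index'] <;> intros <;> simp [add_mul, add_smul, Finsupp.sum_add])
    (fun c f g => by
      unfold sMul
      rw [Finsupp.sum_smul_index (by simp), Finsupp.smul_sum]
      simp [Finsupp.smul_sum, mul_assoc, smul_smul])
    (fun f g g' => by
      unfold sMul
      rw [← Finsupp.sum_add]
      refine Finsupp.sum_congr fun q _ => ?_
      rw [Finsupp.sum_add_index'] <;> intros <;> simp [mul_add, add_smul])
    (fun c f g => by
      unfold sMul
      rw [Finsupp.smul_sum]
      refine Finsupp.sum_congr fun q _ => ?_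
      rw [Finsupp.sum_smul_index (by simp), Finsupp.smul_sum]
      simp [mul_left_comm, smul_smul])

lemma mulL_apply (f g : SAlg F n n') : mulL f g = sMul f g := rfl

lemma mulL_single (q r : SIdx n n') (c d : F) :
    mulL (Finsupp.single q c) (Finsupp.single r d) = (c * d) • sMulB q r := by
  simp [mulL_apply, sMul]

/-- The even partial derivative as a linear map. -/
def deL (i : Fin n) : SAlg F n n' →ₗ[F] SAlg F n n' where
  toFun := De i
  map_add' f g := by
    unfold De
    rw [Finsupp.sum_add_index'] <;> intros <;> split_ifs <;> simp
  map_smul' c f := by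
    unfold De
    rw [Finsupp.sum_smul_index (by simp), RingHom.id_apply, Finsupp.smul_sum]
    refine Finsupp.sum_congr fun q _ => ?_
    split_ifs <;> simp

lemma deL_apply (i : Fin n) (f : SAlg F n n') : deL i f = De i f := rfl

lemma deL_single (i : Fin n) (q : SIdx n n') (c : F) :
    deL i (Finsupp.single q c) =
      if 0 < q.1 i then Finsupp.single (Function.update q.1 i (q.1 i - 1), q.2) c else 0 := by
  simp [deL_apply, De]

/-- The odd partial derivative as a linear map. -/
def doL (j : Fin n') : SAlg F n n' →ₗ[F] SAlg F n n' where
  toFun := Do j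
  map_add' f g := by
    unfold Do
    rw [Finsupp.sum_add_index'] <;> intros <;> split_ifs <;> simp [mul_add]
  map_smul' c f := by
    unfold Do
    rw [Finsupp.sum_smul_index (by simp), RingHom.id_apply, Finsupp.smul_sum]
    refine Finsupp.sum_congr fun q _ => ?_
    split_ifs <;> simp only [smul_smul, smul_zero, mul_left_comm]

lemma doL_apply (j : Fin n') (f : SAlg F n n') : doL j f = Do j f := rfl

lemma doL_single (j : Fin n') (q : SIdx n n') (c : F) :
    doL j (Finsupp.single q c) =
      if j ∈ q.2 then Finsupp.single (q.1, q.2.erase j) (mulSign F {j} (q.2.erase j) * c)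
      else 0 := by
  simp [doL_apply, Do, neg_one_pow_filter_lt]

/-- The elements of parity `c`. -/
def homog (F : Type*) [Field F] (n n' : ℕ) (c : ZMod 2) : Submodule F (SAlg F n n') :=
  Finsupp.supported F F {q | (q.2.card : ZMod 2) = c}

lemma single_mem_homog (q : SIdx n n') (a : F) :
    Finsupp.single q a ∈ homog F n n' q.2.card :=
  Finsupp.single_mem_supported F a rfl

/-- A submodule of supported elements is stable under `L` as soon as `L` maps the monomials into
the target. -/
lemma map_mem_of_supported {V W : Type*} [AddCommGroup V] [Module F V] {S : Set W}
    {P : Submodule F V} (L : (W →₀ F) →ₗ[F] V) (hL : ∀ q ∈ S, L (Finsupp.single q 1) ∈ P)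
    {f : W →₀ F} (hf : f ∈ Finsupp.supported F F S) : L f ∈ P := by
  rw [Finsupp.supported_eq_span_single] at hf
  have : Submodule.span F ((fun q => Finsupp.single q (1 : F)) '' S) ≤ P.comap L := by
    rw [Submodule.span_le]
    rintro _ ⟨q, hq, rfl⟩
    exact hL q hq
  exact this hf

/-- Two linear maps agree on supported elements if they agree on monomials. -/
lemma eq_of_supported {V W : Type*} [AddCommGroup V] [Module F V] {S : Set W}
    (L L' : (W →₀ F) →ₗ[F] V)
    (hL : ∀ q ∈ S, L (Finsupp.single q 1) = L' (Finsupp.single q 1))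
    {f : W →₀ F} (hf : f ∈ Finsupp.supported F F S) : L f = L' f := by
  have := map_mem_of_supported (P := ⊥) (L - L') (fun q hq => by simp [hL q hq]) hf
  simpa [sub_eq_zero] using this

lemma deL_mem_homog {c : ZMod 2} {f : SAlg F n n'} (i : Fin n) (hf : f ∈ homog F n n' c) :
    deL i f ∈ homog F n n' c := by
  refine map_mem_of_supported _ (fun q hq => ?_) hf
  rw [deL_single]
  split_ifs
  · exact Finsupp.single_mem_supported F _ hq
  · exact zero_mem _

lemma doL_mem_homog {c : ZMod 2} {f : SAlg F n n'} (j : Fin n') (hf : f ∈ homog F n n' c) :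
    doL j f ∈ homog F n n' (c + 1) := by
  refine map_mem_of_supported _ (fun q hq => ?_) hf
  rw [doL_single]
  split_ifs with hj
  · refine Finsupp.single_mem_supported F _ ?_
    have h2 : (1 + 1 : ZMod 2) = 0 := by decide
    have h1 := Finset.card_erase_add_one hj
    simp only [Set.mem_ofPred_eq] at hq ⊢
    rw [← hq, ← h1, Nat.cast_succ, add_assoc, h2, add_zero]
  · exact zero_mem _

lemma mulL_mem_homog {c d : ZMod 2} {f g : SAlg F n n'} (hf : f ∈ homog F n n' c)
    (hg : g ∈ homog F n n' d) : mulL f g ∈ homog F n n' (c + d) := by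
  refine map_mem_of_supported (mulL.flip g) (fun q hq => ?_) hf
  refine map_mem_of_supported (mulL (Finsupp.single q 1)) (fun r hr => ?_) hg
  rw [mulL_single]
  refine Submodule.smul_mem _ _ ?_
  unfold sMulB
  split_ifs with hd
  · refine Submodule.smul_mem _ _ (Finsupp.single_mem_supported F _ ?_)
    simp only [Set.mem_ofPred_eq] at hq hr ⊢
    rw [Finset.card_union_of_disjoint hd, Nat.cast_add, hq, hr]
  · exact zero_mem _

/-! ### Structure of the superalgebra -/

/-- The coefficient of `x^(α+β)` in `x^(α) x^(β)`. -/
def divPowCoeff (F : Type*) [Field F] (a b : Fin n → ℕ) : F :=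
  ∏ i, ((a i + b i).choose (a i) : F)

lemma divPowCoeff_comm (a b : Fin n → ℕ) : divPowCoeff F a b = divPowCoeff F b a := by
  refine Finset.prod_congr rfl fun i _ => ?_
  rw [add_comm (b i), ← Nat.choose_symm_add]

lemma divPowCoeff_assoc (F : Type*) [Field F] (a b c : Fin n → ℕ) :
    divPowCoeff F a b * divPowCoeff F (a + b) c =
      divPowCoeff F b c * divPowCoeff F a (b + c) := by
  unfold divPowCoeff
  rw [← Finset.prod_mul_distrib, ← Finset.prod_mul_distrib]
  refine Finset.prod_congr rfl fun i _ => ?_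
  have h := Nat.choose_mul (n := a i + b i + c i) (k := a i + b i) (s := a i) (by omega)
  rw [show a i + b i + c i - a i = b i + c i by omega, Nat.add_sub_cancel_left] at h
  have h' := congrArg (Nat.cast (R := F)) h
  push_cast at h'
  rw [Pi.add_apply, Pi.add_apply, ← add_assoc]
  linear_combination h'

lemma divPowCoeff_eq (i : Fin n) (a b : Fin n → ℕ) :
    divPowCoeff F a b = ((a i + b i).choose (a i) : F) *
      ∏ k ∈ Finset.univ.erase i, ((a k + b k).choose (a k) : F) :=
  (Finset.mul_prod_erase _ _ (Finset.mem_univ i)).symm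

lemma divPowCoeff_update_left (i : Fin n) (a b : Fin n → ℕ) (x : ℕ) :
    divPowCoeff F (Function.update a i x) b = ((x + b i).choose x : F) *
      ∏ k ∈ Finset.univ.erase i, ((a k + b k).choose (a k) : F) := by
  rw [divPowCoeff_eq i, Function.update_self]
  congr 1
  refine Finset.prod_congr rfl fun k hk => ?_
  rw [Function.update_of_ne (Finset.ne_of_mem_erase hk)]

lemma divPowCoeff_update_right (i : Fin n) (a b : Fin n → ℕ) (x : ℕ) :
    divPowCoeff F a (Function.update b i x) = ((a i + x).choose (a i) : F) *
      ∏ k ∈ Finset.univ.erase i, ((a k + b k).choose (a k) : F) := by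
  rw [divPowCoeff_eq i, Function.update_self]
  congr 1
  refine Finset.prod_congr rfl fun k hk => ?_
  rw [Function.update_of_ne (Finset.ne_of_mem_erase hk)]

/-- The product of monomials as a single monomial. -/
lemma sMulB_of_disjoint {q r : SIdx n n'} (h : Disjoint q.2 r.2) :
    sMulB q r = Finsupp.single (q.1 + r.1, q.2 ∪ r.2)
      (mulSign F q.2 r.2 * divPowCoeff F q.1 r.1) := by
  rw [sMulB, if_pos h, Finsupp.smul_single, smul_eq_mul, mul_one]
  rfl

lemma sMulB_of_not_disjoint {q r : SIdx n n'} (h : ¬ Disjoint q.2 r.2) :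
    (sMulB q r : SAlg F n n') = 0 := if_neg h

lemma mulL_single_of_disjoint {q r : SIdx n n'} (h : Disjoint q.2 r.2) (c d : F) :
    mulL (Finsupp.single q c) (Finsupp.single r d) = Finsupp.single (q.1 + r.1, q.2 ∪ r.2)
      (c * d * (mulSign F q.2 r.2 * divPowCoeff F q.1 r.1)) := by
  rw [mulL_single, sMulB_of_disjoint h, Finsupp.smul_single, smul_eq_mul]

lemma mulL_single_of_not_disjoint {q r : SIdx n n'} (h : ¬ Disjoint q.2 r.2) (c d : F) :
    mulL (Finsupp.single q c) (Finsupp.single r d) = 0 := by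
  rw [mulL_single, sMulB_of_not_disjoint h, smul_zero]

lemma mulL_assoc (f g k : SAlg F n n') : mulL (mulL f g) k = mulL f (mulL g k) := by
  induction f using Finsupp.induction_linear with
  | zero => simp
  | add f f' h h' => simp only [map_add, LinearMap.add_apply, h, h']
  | single q a =>
  induction g using Finsupp.induction_linear with
  | zero => simp
  | add g g' h h' => simp only [map_add, LinearMap.add_apply, h, h']
  | single r b =>
  induction k using Finsupp.induction_linear with
  | zero => simp
  | add k k' h h' => simp only [map_add, h, h']
  | single s c =>
  by_cases hqr : Disjoint q.2 r.2
  · rw [mulL_single_of_disjoint hqr]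
    by_cases hrs : Disjoint r.2 s.2
    · rw [mulL_single_of_disjoint hrs]
      by_cases hqs : Disjoint q.2 s.2
      · rw [mulL_single_of_disjoint (Finset.disjoint_union_left.2 ⟨hqs, hrs⟩),
          mulL_single_of_disjoint (Finset.disjoint_union_right.2 ⟨hqr, hqs⟩)]
        simp only [add_assoc, Finset.union_assoc, mulSign_union_left _ hqr,
          mulSign_union_right _ hrs]
        congr 1
        linear_combination a * b * c * mulSign F q.2 r.2 * mulSign F q.2 s.2 *
          mulSign F r.2 s.2 * divPowCoeff_assoc F q.1 r.1 s.1
      · rw [mulL_single_of_not_disjoint fun h => hqs (Finset.disjoint_union_left.1 h).1,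
          mulL_single_of_not_disjoint fun h => hqs (Finset.disjoint_union_right.1 h).2]
    · rw [mulL_single_of_not_disjoint hrs,
        mulL_single_of_not_disjoint fun h => hrs (Finset.disjoint_union_left.1 h).2, map_zero]
  · rw [mulL_single_of_not_disjoint hqr, map_zero, LinearMap.zero_apply]
    by_cases hrs : Disjoint r.2 s.2
    · rw [mulL_single_of_disjoint hrs,
        mulL_single_of_not_disjoint fun h => hqr (Finset.disjoint_union_right.1 h).1]
    · rw [mulL_single_of_not_disjoint hrs, map_zero]

lemma mulL_comm {c d : ZMod 2} {f g : SAlg F n n'} (hf : f ∈ homog F n n' c)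
    (hg : g ∈ homog F n n' d) : mulL f g = sgn F (c * d) • mulL g f := by
  refine eq_of_supported (mulL.flip g) (sgn F (c * d) • mulL g) (fun q hq => ?_) hf
  refine eq_of_supported (mulL (Finsupp.single q 1))
    (sgn F (c * d) • mulL.flip (Finsupp.single q 1)) (fun r hr => ?_) hg
  simp only [Set.mem_ofPred_eq] at hq hr
  subst hq hr
  rw [LinearMap.smul_apply, LinearMap.flip_apply, mulL_single, mulL_single, ← Nat.cast_mul,
    sgn_natCast]
  by_cases h : Disjoint q.2 r.2
  · rw [sMulB_of_disjoint h, sMulB_of_disjoint h.symm, mulSign_comm h, add_comm r.1,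
      Finset.union_comm r.2]
    simp only [one_mul, one_smul, Finsupp.smul_single, smul_eq_mul, mul_assoc]
    rw [divPowCoeff_comm]
  · rw [sMulB_of_not_disjoint h, sMulB_of_not_disjoint fun h' => h h'.symm]
    simp

lemma deL_mul (i : Fin n) (f g : SAlg F n n') :
    deL i (mulL f g) = mulL (deL i f) g + mulL f (deL i g) := by
  induction f using Finsupp.induction_linear with
  | zero => simp
  | add f f' h h' => simp only [map_add, LinearMap.add_apply, h, h']; abel
  | single q a =>
  induction g using Finsupp.induction_linear with
  | zero => simp
  | add g g' h h' => simp only [map_add, h, h']; abel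
  | single r b =>
  obtain ⟨q, u⟩ := q
  obtain ⟨r, v⟩ := r
  by_cases hd : Disjoint u v
  · rw [mulL_single_of_disjoint hd]
    simp only [deL_single, Pi.add_apply]
    have e1 (h : 0 < q i) : Function.update q i (q i - 1) + r =
        Function.update (q + r) i (q i + r i - 1) := by
      ext k
      rcases eq_or_ne k i with rfl | hk
      · simp only [Pi.add_apply, Function.update_self]; omega
      · simp [Function.update_of_ne hk]
    have e2 (h : 0 < r i) : q + Function.update r i (r i - 1) =
        Function.update (q + r) i (q i + r i - 1) := by
      ext k
      rcases eq_or_ne k i with rfl | hk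
      · simp only [Pi.add_apply, Function.update_self]; omega
      · simp [Function.update_of_ne hk]
    by_cases hq : 0 < q i <;> by_cases hr : 0 < r i
    · rw [if_pos (by omega), if_pos hq, if_pos hr, mulL_single_of_disjoint hd,
        mulL_single_of_disjoint hd]
      simp only
      rw [e1 hq, e2 hr, ← Finsupp.single_add, divPowCoeff_update_left, divPowCoeff_update_right,
        divPowCoeff_eq i]
      congr 1
      obtain ⟨x, hx⟩ := Nat.exists_eq_add_of_lt hq
      obtain ⟨y, hy⟩ := Nat.exists_eq_add_of_lt hr
      have h3 : ((q i + r i).choose (q i) : F) =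
          ((q i - 1 + r i).choose (q i - 1) : F) + ((q i + (r i - 1)).choose (q i) : F) := by
        rw [← Nat.cast_add, hx, hy]
        congr 1
        simp only [zero_add, Nat.add_sub_cancel]
        rw [show x + 1 + (y + 1) = (x + (y + 1)) + 1 by omega, Nat.choose_succ_succ,
          show x + 1 + y = x + (y + 1) by omega]
      rw [h3]
      ring
    · rw [if_pos (by omega), if_pos hq, if_neg hr, mulL_single_of_disjoint hd]
      simp only
      rw [e1 hq, map_zero, add_zero, divPowCoeff_update_left, divPowCoeff_eq i]
      simp [Nat.eq_zero_of_not_pos hr]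
    · rw [if_pos (by omega), if_neg hq, if_pos hr, mulL_single_of_disjoint hd]
      simp only
      rw [e2 hr, map_zero, LinearMap.zero_apply, zero_add, divPowCoeff_update_right,
        divPowCoeff_eq i]
      simp [Nat.eq_zero_of_not_pos hq]
    · rw [if_neg (by omega), if_neg hq, if_neg hr]
      simp
  · rw [mulL_single_of_not_disjoint hd]
    simp only [deL_single]
    split_ifs <;> simp [mulL_single, sMulB_of_not_disjoint, hd]

lemma mulSign_singleton_mul {j : Fin n'} {u : Finset (Fin n')} (h : j ∉ u) :
    mulSign F u {j} = (-1) ^ u.card * mulSign F {j} u := by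
  rw [mulSign_comm (Finset.disjoint_singleton_right.2 h)]
  simp

lemma doL_mul (j : Fin n') {c : ZMod 2} {f : SAlg F n n'} (hf : f ∈ homog F n n' c)
    (g : SAlg F n n') :
    doL j (mulL f g) = mulL (doL j f) g + sgn F c • mulL f (doL j g) := by
  refine eq_of_supported ((doL j).comp (mulL.flip g))
    ((mulL.flip g).comp (doL j) + sgn F c • mulL.flip (doL j g)) (fun q hq => ?_) hf
  simp only [Set.mem_ofPred_eq] at hq
  subst hq
  simp only [LinearMap.comp_apply, LinearMap.add_apply, LinearMap.smul_apply, LinearMap.flip_apply,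
    sgn_natCast]
  induction g using Finsupp.induction_linear with
  | zero => simp
  | add g g' h h' => simp only [map_add, smul_add, h, h']; abel
  | single r b =>
  obtain ⟨q, u⟩ := q
  obtain ⟨r, v⟩ := r
  simp only [doL_single]
  by_cases hu : j ∈ u
  · obtain ⟨u, hju, rfl⟩ : ∃ u', j ∉ u' ∧ u = {j} ∪ u' :=
      ⟨u.erase j, by simp, by rw [← Finset.insert_eq, Finset.insert_erase hu]⟩
    have hju' : Disjoint {j} u := Finset.disjoint_singleton_left.2 hju
    have eu : ({j} ∪ u).erase j = u := by rw [← Finset.insert_eq, Finset.erase_insert hju]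
    have cu : ({j} ∪ u).card = u.card + 1 := by
      rw [← Finset.insert_eq, Finset.card_insert_of_notMem hju]
    rw [if_pos hu, eu, cu]
    by_cases hv : j ∈ v
    · obtain ⟨v, hjv, rfl⟩ : ∃ v', j ∉ v' ∧ v = {j} ∪ v' :=
        ⟨v.erase j, by simp, by rw [← Finset.insert_eq, Finset.insert_erase hv]⟩
      have hjv' : Disjoint {j} v := Finset.disjoint_singleton_left.2 hjv
      have ev : ({j} ∪ v).erase j = v := by rw [← Finset.insert_eq, Finset.erase_insert hjv]
      rw [if_pos hv, ev, mulL_single_of_not_disjoint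
        (fun h => Finset.disjoint_left.1 h hu hv), map_zero]
      by_cases hd : Disjoint u v
      · rw [mulL_single_of_disjoint (Finset.disjoint_union_right.2 ⟨hju'.symm, hd⟩),
          mulL_single_of_disjoint (Finset.disjoint_union_left.2 ⟨hjv', hd⟩)]
        simp only [mulSign_union_right _ hjv', mulSign_union_left _ hju',
          mulSign_singleton_mul hju, Finsupp.smul_single]
        rw [show u ∪ ({j} ∪ v) = {j} ∪ u ∪ v by rw [← Finset.union_assoc, Finset.union_comm u],
          ← Finsupp.single_add, eq_comm, Finsupp.single_eq_zero]
        have h1 := mulSign_mul_self (F := F) {j} u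
        have h2 := mulSign_mul_self (F := F) {j} v
        simp only [smul_eq_mul]
        linear_combination (-1) ^ u.card * b * mulSign F u v * divPowCoeff F q r * (h1 - h2)
      · rw [mulL_single_of_not_disjoint fun h => hd (Finset.disjoint_union_right.1 h).2,
          mulL_single_of_not_disjoint fun h => hd (Finset.disjoint_union_left.1 h).2]
        simp
    · rw [if_neg hv, map_zero, smul_zero, add_zero]
      have hjv' : Disjoint {j} v := Finset.disjoint_singleton_left.2 hv
      by_cases hd : Disjoint u v
      · rw [mulL_single_of_disjoint (Finset.disjoint_union_left.2 ⟨hjv', hd⟩),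
          mulL_single_of_disjoint hd, doL_single, if_pos (by simp)]
        have e : ({j} ∪ u ∪ v).erase j = u ∪ v := by
          rw [Finset.union_assoc, ← Finset.insert_eq, Finset.erase_insert (by simp [hju, hv])]
        simp only [e, mulSign_union_right _ hd, mulSign_union_left _ hju']
        congr 1
        have h2 := mulSign_mul_self (F := F) {j} v
        linear_combination mulSign F {j} u * b * mulSign F u v * divPowCoeff F q r * h2
      · rw [mulL_single_of_not_disjoint fun h => hd (Finset.disjoint_union_left.1 h).2,
          mulL_single_of_not_disjoint hd, map_zero]
  · rw [if_neg hu, map_zero, LinearMap.zero_apply, zero_add]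
    have hju' : Disjoint {j} u := Finset.disjoint_singleton_left.2 hu
    by_cases hv : j ∈ v
    · obtain ⟨v, hjv, rfl⟩ : ∃ v', j ∉ v' ∧ v = {j} ∪ v' :=
        ⟨v.erase j, by simp, by rw [← Finset.insert_eq, Finset.insert_erase hv]⟩
      have hjv' : Disjoint {j} v := Finset.disjoint_singleton_left.2 hjv
      have ev : ({j} ∪ v).erase j = v := by rw [← Finset.insert_eq, Finset.erase_insert hjv]
      rw [if_pos hv, ev]
      by_cases hd : Disjoint u v
      · rw [mulL_single_of_disjoint (Finset.disjoint_union_right.2 ⟨hju'.symm, hd⟩),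
          mulL_single_of_disjoint hd, doL_single, if_pos (by simp)]
        have e : (u ∪ ({j} ∪ v)).erase j = u ∪ v := by
          rw [Finset.union_left_comm, ← Finset.insert_eq, Finset.erase_insert (by simp [hjv, hu])]
        simp only [e, mulSign_union_right _ hd, mulSign_union_right _ hjv',
          mulSign_singleton_mul hu, Finsupp.smul_single, smul_eq_mul]
        congr 1
        have h2 := mulSign_mul_self (F := F) {j} u
        linear_combination (-1) ^ u.card * mulSign F {j} v * b * mulSign F u v *
          divPowCoeff F q r * h2
      · rw [mulL_single_of_not_disjoint fun h => hd (Finset.disjoint_union_right.1 h).2,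
          mulL_single_of_not_disjoint hd, map_zero, smul_zero]
    · rw [if_neg hv, map_zero, smul_zero, mulL_single]
      by_cases hd : Disjoint u v
      · rw [sMulB_of_disjoint hd, Finsupp.smul_single, doL_single, if_neg (by simp [hu, hv])]
      · rw [sMulB_of_not_disjoint hd, smul_zero, map_zero]

lemma deL_deL (i j : Fin n) (f : SAlg F n n') : deL i (deL j f) = deL j (deL i f) := by
  induction f using Finsupp.induction_linear with
  | zero => simp
  | add f f' h h' => simp only [map_add, h, h']
  | single q a =>
  rcases eq_or_ne i j with rfl | hij
  · rfl
  · simp only [deL_single]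
    by_cases hi : 0 < q.1 i <;> by_cases hj : 0 < q.1 j <;>
      simp [hi, hj, deL_single, Function.update_of_ne hij, Function.update_of_ne hij.symm,
        Function.update_comm hij]

lemma deL_doL (i : Fin n) (j : Fin n') (f : SAlg F n n') : deL i (doL j f) = doL j (deL i f) := by
  induction f using Finsupp.induction_linear with
  | zero => simp
  | add f f' h h' => simp only [map_add, h, h']
  | single q a =>
  simp only [deL_single, doL_single]
  by_cases hi : 0 < q.1 i <;> by_cases hj : j ∈ q.2 <;> 
    simp [hi, hj, deL_single, doL_single, -Finsupp.single_mul]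

lemma doL_doL (i j : Fin n') (f : SAlg F n n') : doL i (doL j f) = - doL j (doL i f) := by
  induction f using Finsupp.induction_linear with
  | zero => simp
  | add f f' h h' => simp only [map_add, h, h', neg_add]
  | single q a =>
  obtain ⟨q, u⟩ := q
  rcases eq_or_ne i j with rfl | hij
  · by_cases hi : i ∈ u <;> simp [doL_single, hi, -Finsupp.single_mul]
  · by_cases hi : i ∈ u <;> by_cases hj : j ∈ u
    · obtain ⟨w, hiw, hjw, hw⟩ : ∃ w, i ∉ w ∧ j ∉ w ∧ u = {i} ∪ ({j} ∪ w) :=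
        ⟨(u.erase i).erase j, by simp, by simp, by
          rw [← Finset.insert_eq, ← Finset.insert_eq, Finset.insert_erase (by simp [hj, hij.symm]),
            Finset.insert_erase hi]⟩
      have ei : u.erase i = {j} ∪ w := by
        rw [hw, ← Finset.insert_eq, Finset.erase_insert (by simp [hij, hiw])]
      have ej : u.erase j = {i} ∪ w := by
        rw [hw, Finset.union_left_comm, ← Finset.insert_eq,
          Finset.erase_insert (by simp [hij.symm, hjw])]
      have eij : ({i} ∪ w).erase i = w := by rw [← Finset.insert_eq, Finset.erase_insert hiw]
      have eji : ({j} ∪ w).erase j = w := by rw [← Finset.insert_eq, Finset.erase_insert hjw]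
      simp only [doL_single, if_pos hi, if_pos hj, ei, ej]
      rw [if_pos (by simp), if_pos (by simp), eij, eji,
        mulSign_union_right _ (Finset.disjoint_singleton_left.2 hiw),
        mulSign_union_right _ (Finset.disjoint_singleton_left.2 hjw),
        mulSign_singleton_mul (u := {j}) (by simpa using hij), Finset.card_singleton,
        ← Finsupp.single_neg]
      congr 1
      ring
    all_goals simp [doL_single, hi, hj, -Finsupp.single_mul]

/-! ### The bracket identity `[T_H(a), T_H(b)] = T_H(T_H(a)(b))` -/

/-- The operator `T_H(a)`, bilinearly in `a` and its argument. -/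
def thL (c : ZMod 2) : SAlg F n n →ₗ[F] SAlg F n n →ₗ[F] SAlg F n n :=
  ∑ i : Fin n, mulL.compl₁₂ (deL i) (doL i) + sgn F c • ∑ i : Fin n, mulL.compl₁₂ (doL i) (deL i)

lemma thL_apply (c : ZMod 2) (a b : SAlg F n n) : thL c a b =
    ∑ i : Fin n, mulL (deL i a) (doL i b) + sgn F c • ∑ i : Fin n, mulL (doL i a) (deL i b) := by
  simp [thL]

lemma thL_eq_TH (c : ZMod 2) (a b : SAlg F n n) : thL c a b = TH c a b := thL_apply c a b

lemma thL_apply' (c : ZMod 2) (a b : SAlg F n n) : thL c a b =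
    ∑ i : Fin n, (mulL (deL i a) (doL i b) + sgn F c • mulL (doL i a) (deL i b)) := by
  rw [thL_apply, Finset.sum_add_distrib, Finset.smul_sum]

lemma one_add_one_zmod : (1 + 1 : ZMod 2) = 0 := by decide

section Bracket

variable {pa pb : ZMod 2} {a b : SAlg F n n}

lemma thL_mem_homog (ha : a ∈ homog F n n pa) (hb : b ∈ homog F n n pb) :
    thL pa a b ∈ homog F n n (pa + pb + 1) := by
  rw [thL_apply']
  refine Submodule.sum_mem _ fun i _ => add_mem ?_ (Submodule.smul_mem _ _ ?_)
  · have := mulL_mem_homog (deL_mem_homog i ha) (doL_mem_homog i hb)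
    rwa [← add_assoc] at this
  · have := mulL_mem_homog (doL_mem_homog i ha) (deL_mem_homog i hb)
    rwa [add_right_comm] at this

lemma thL_symm (ha : a ∈ homog F n n pa) (hb : b ∈ homog F n n pb) :
    thL pb b a = -sgn F ((pa + 1) * (pb + 1)) • thL pa a b := by
  rw [thL_apply', thL_apply', Finset.smul_sum]
  refine Finset.sum_congr rfl fun i _ => ?_
  rw [mulL_comm (deL_mem_homog i hb) (doL_mem_homog i ha),
    mulL_comm (doL_mem_homog i hb) (deL_mem_homog i ha)]
  rcases zmod_two_cases pa with rfl | rfl <;> rcases zmod_two_cases pb with rfl | rfl <;>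
    simp only [one_add_one_zmod, sgn_zero, sgn_one, zero_add, mul_zero, mul_one] <;>
    module

lemma thL_mul (ha : a ∈ homog F n n pa) (hb : b ∈ homog F n n pb) (c : SAlg F n n) :
    thL pa a (mulL b c) =
      mulL (thL pa a b) c + sgn F ((pa + 1) * pb) • mulL b (thL pa a c) := by
  rw [thL_apply', thL_apply', thL_apply', map_sum, map_sum, LinearMap.sum_apply, Finset.smul_sum,
    ← Finset.sum_add_distrib]
  refine Finset.sum_congr rfl fun i _ => ?_
  simp only [doL_mul i hb, deL_mul, map_add, map_smul, LinearMap.add_apply, LinearMap.smul_apply,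
    ← mulL_assoc]
  rw [mulL_comm (deL_mem_homog i ha) hb, mulL_comm (doL_mem_homog i ha) hb]
  simp only [map_smul, LinearMap.smul_apply]
  rcases zmod_two_cases pa with rfl | rfl <;> rcases zmod_two_cases pb with rfl | rfl <;>
    simp only [one_add_one_zmod, sgn_zero, sgn_one, zero_add, mul_zero, mul_one] <;>
    module

lemma deL_thL (j : Fin n) (c : ZMod 2) (a b : SAlg F n n) :
    deL j (thL c a b) = thL c (deL j a) b + thL c a (deL j b) := by
  simp only [thL_apply', map_sum, ← Finset.sum_add_distrib]
  refine Finset.sum_congr rfl fun i _ => ?_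
  simp only [map_add, map_smul, deL_mul, deL_doL, deL_deL j i]
  module

lemma doL_thL (j : Fin n) (ha : a ∈ homog F n n pa) (b : SAlg F n n) :
    doL j (thL pa a b) = thL (pa + 1) (doL j a) b - sgn F pa • thL pa a (doL j b) := by
  simp only [thL_apply', map_sum, Finset.smul_sum, ← Finset.sum_sub_distrib]
  refine Finset.sum_congr rfl fun i _ => ?_
  simp only [map_add, map_smul, doL_mul j (deL_mem_homog i ha), doL_mul j (doL_mem_homog i ha),
    deL_doL, doL_doL j i, map_neg, LinearMap.neg_apply, sgn_add, sgn_one]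
  rcases zmod_two_cases pa with rfl | rfl <;> simp only [sgn_zero, sgn_one] <;> module

/-- The terms of `T_H(a) T_H(b) c` in which `c` is differentiated twice. -/
def secondOrder (pa pb : ZMod 2) (a b c : SAlg F n n) : SAlg F n n :=
  ∑ j : Fin n, (sgn F ((pa + 1) * pb) • mulL (deL j b) (thL pa a (doL j c)) +
    sgn F (pb + (pa + 1) * (pb + 1)) • mulL (doL j b) (thL pa a (deL j c)))

lemma secondOrder_symm (ha : a ∈ homog F n n pa) (hb : b ∈ homog F n n pb) (c : SAlg F n n) :
    secondOrder pa pb a b c = sgn F ((pa + 1) * (pb + 1)) • secondOrder pb pa b a c := by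
  have hd (a b : SAlg F n n) (pa pb) : secondOrder pa pb a b c = ∑ j : Fin n, ∑ i : Fin n,
      (sgn F ((pa + 1) * pb) • (mulL (mulL (deL j b) (deL i a)) (doL i (doL j c)) +
        sgn F pa • mulL (mulL (deL j b) (doL i a)) (deL i (doL j c))) +
      sgn F (pb + (pa + 1) * (pb + 1)) • (mulL (mulL (doL j b) (deL i a)) (doL i (deL j c)) +
        sgn F pa • mulL (mulL (doL j b) (doL i a)) (deL i (deL j c)))) := by
    simp only [secondOrder, thL_apply', map_sum, Finset.smul_sum, ← Finset.sum_add_distrib,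
      map_add, map_smul, mulL_assoc]
  rw [hd, hd, Finset.sum_comm, Finset.smul_sum]
  refine Finset.sum_congr rfl fun i _ => ?_
  rw [Finset.smul_sum]
  refine Finset.sum_congr rfl fun j _ => ?_
  rw [mulL_comm (deL_mem_homog j hb) (deL_mem_homog i ha),
    mulL_comm (deL_mem_homog j hb) (doL_mem_homog i ha),
    mulL_comm (doL_mem_homog j hb) (deL_mem_homog i ha),
    mulL_comm (doL_mem_homog j hb) (doL_mem_homog i ha),
    doL_doL i j, deL_deL i j, deL_doL, deL_doL]
  simp only [map_smul, LinearMap.smul_apply, map_neg]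
  rcases zmod_two_cases pa with rfl | rfl <;> rcases zmod_two_cases pb with rfl | rfl <;>
    simp only [one_add_one_zmod, sgn_zero, sgn_one, zero_add, add_zero, mul_zero,
      mul_one] <;>
    module

lemma thL_thL (ha : a ∈ homog F n n pa) (hb : b ∈ homog F n n pb) (c : SAlg F n n) :
    thL pa a (thL pb b c) = ∑ j : Fin n, (mulL (thL pa a (deL j b)) (doL j c) +
      sgn F pb • mulL (thL pa a (doL j b)) (deL j c)) + secondOrder pa pb a b c := by
  rw [thL_apply' pb b c, map_sum, secondOrder, ← Finset.sum_add_distrib]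
  refine Finset.sum_congr rfl fun j _ => ?_
  rw [map_add, map_smul, thL_mul ha (deL_mem_homog j hb), thL_mul ha (doL_mem_homog j hb),
    sgn_add pb]
  module

/-- The supercommutator of two odd Hamiltonian operators is odd Hamiltonian. -/
lemma thL_bracket (ha : a ∈ homog F n n pa) (hb : b ∈ homog F n n pb) (c : SAlg F n n) :
    thL pa a (thL pb b c) - sgn F ((pa + 1) * (pb + 1)) • thL pb b (thL pa a c) =
      thL (pa + pb + 1) (thL pa a b) c := by
  rw [thL_thL ha hb, thL_thL hb ha, secondOrder_symm ha hb, smul_add, add_sub_add_right_eq_sub,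
    thL_apply' (pa + pb + 1), Finset.smul_sum, ← Finset.sum_sub_distrib]
  refine Finset.sum_congr rfl fun j _ => ?_
  rw [deL_thL, doL_thL j ha, thL_symm (deL_mem_homog j ha) hb, thL_symm (doL_mem_homog j ha) hb]
  simp only [map_add, map_sub, map_smul, LinearMap.add_apply, LinearMap.sub_apply,
    LinearMap.smul_apply]
  rcases zmod_two_cases pa with rfl | rfl <;> rcases zmod_two_cases pb with rfl | rfl <;>
    simp only [one_add_one_zmod, sgn_zero, sgn_one, zero_add, add_zero, mul_zero,
      mul_one] <;>
    module

end Bracket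

/-! ### Graded pieces of the truncated algebra -/

/-- The monomials of `𝒪(n, n'; t̲)` of degree `d`. -/
def truncIdx (n' p : ℕ) (t : Fin n → ℕ) (d : ℕ) : Set (SIdx n n') :=
  {q | (∀ i, q.1 i ≤ p ^ t i - 1) ∧ (∑ i, q.1 i) + q.2.card = d}

lemma deL_mem_truncIdx {p d : ℕ} {t : Fin n → ℕ} {q : SIdx n n'} (i : Fin n)
    (hq : q ∈ truncIdx n' p t (d + 1)) :
    deL i (Finsupp.single q 1) ∈ Finsupp.supported F F (truncIdx n' p t d) := by
  rw [deL_single]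
  split_ifs with h
  · refine Finsupp.single_mem_supported F _ ⟨fun k => ?_, ?_⟩
    · rcases eq_or_ne k i with rfl | hk
      · simpa using (Nat.sub_le _ _).trans (hq.1 k)
      · simpa [Function.update_of_ne hk] using hq.1 k
    · have h1 := hq.2
      dsimp only
      rw [← Finset.add_sum_erase _ _ (Finset.mem_univ i)] at h1 ⊢
      rw [Finset.sum_congr rfl fun k hk =>
        Function.update_of_ne (Finset.ne_of_mem_erase hk) _ _, Function.update_self]
      omega
  · exact zero_mem _

lemma doL_mem_truncIdx {p d : ℕ} {t : Fin n → ℕ} {q : SIdx n n'} (j : Fin n')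
    (hq : q ∈ truncIdx n' p t (d + 1)) :
    doL j (Finsupp.single q 1) ∈ Finsupp.supported F F (truncIdx n' p t d) := by
  rw [doL_single]
  split_ifs with h
  · refine Finsupp.single_mem_supported F _ ⟨hq.1, ?_⟩
    have h1 := hq.2
    have h2 := Finset.card_erase_add_one h
    dsimp only
    omega
  · exact zero_mem _

lemma prime_dvd_choose_add {p t a b : ℕ} (hp : p.Prime) (ha : a < p ^ t) (hb : b < p ^ t)
    (hab : p ^ t ≤ a + b) : p ∣ (a + b).choose a := by
  have ht : t ≠ 0 := by rintro rfl; simp only [pow_zero] at ha hb hab; omega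
  have hs := hp.emultiplicity_choose' (n := b) (k := a)
    (b := Nat.log p (b + a) + 1) (Nat.lt_succ_self _)
  rw [add_comm a b]
  rw [← emultiplicity_ne_zero, hs]
  have hmem : t ∈ {i ∈ Finset.Ico 1 (Nat.log p (b + a) + 1) | p ^ i ≤ a % p ^ i + b % p ^ i} := by
    simp only [Finset.mem_filter, Finset.mem_Ico, Nat.mod_eq_of_lt ha, Nat.mod_eq_of_lt hb]
    refine ⟨⟨by omega, Nat.lt_succ_of_le (Nat.le_log_of_pow_le hp.one_lt (by omega))⟩, hab⟩
  exact_mod_cast Finset.card_ne_zero_of_mem hmem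

lemma mulL_mem_truncIdx {p d e : ℕ} (hp : p.Prime) [CharP F p] {t : Fin n → ℕ}
    {f g : SAlg F n n'} (hf : f ∈ Finsupp.supported F F (truncIdx n' p t d))
    (hg : g ∈ Finsupp.supported F F (truncIdx n' p t e)) :
    mulL f g ∈ Finsupp.supported F F (truncIdx n' p t (d + e)) := by
  refine map_mem_of_supported (mulL.flip g) (fun q hq => ?_) hf
  refine map_mem_of_supported (mulL (Finsupp.single q 1)) (fun r hr => ?_) hg
  by_cases hd : Disjoint q.2 r.2
  · rw [mulL_single_of_disjoint hd]
    by_cases hb : ∀ i, q.1 i + r.1 i ≤ p ^ t i - 1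
    · refine Finsupp.single_mem_supported F _ ⟨hb, ?_⟩
      have h1 := hq.2
      have h2 := hr.2
      simp only [Pi.add_apply, Finset.sum_add_distrib, Finset.card_union_of_disjoint hd]
      omega
    · push Not at hb
      obtain ⟨i, hi⟩ := hb
      have hpos := Nat.pow_pos (n := t i) hp.pos
      have h1 := hq.1 i
      have h2 := hr.1 i
      have : divPowCoeff F q.1 r.1 = 0 := by
        rw [divPowCoeff_eq i, (CharP.cast_eq_zero_iff F p _).2
          (prime_dvd_choose_add (t := t i) hp (by omega) (by omega) (by omega)), zero_mul]
      rw [this, mul_zero, mul_zero, Finsupp.single_zero]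
      exact zero_mem _
  · rw [mulL_single_of_not_disjoint hd]
    exact zero_mem _

lemma thL_mem_truncIdx {p d e : ℕ} (hp : p.Prime) [CharP F p] {t : Fin n → ℕ} (c : ZMod 2)
    {q r : SIdx n n} (hq : q ∈ truncIdx n p t (d + 1)) (hr : r ∈ truncIdx n p t (e + 1)) :
    thL c (Finsupp.single q 1) (Finsupp.single r 1) ∈
      Finsupp.supported F F (truncIdx n p t (d + e)) := by
  rw [thL_apply']
  exact Submodule.sum_mem _ fun i _ => add_mem
    (mulL_mem_truncIdx hp (deL_mem_truncIdx i hq) (doL_mem_truncIdx i hr))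
    (Submodule.smul_mem _ _ (mulL_mem_truncIdx hp (doL_mem_truncIdx i hq) (deL_mem_truncIdx i hr)))

lemma THm_eq (q : SIdx n n) : THm F q = thL (q.2.card : ZMod 2) (Finsupp.single q 1) :=
  funext fun b => (thL_eq_TH _ _ b).symm

lemma THm_bracket (q r : SIdx n n) :
    (fun x => THm F q (THm F r x) -
      sgn F (((q.2.card : ZMod 2) + 1) * ((r.2.card : ZMod 2) + 1)) • THm F r (THm F q x)) =
    thL ((q.2.card : ZMod 2) + r.2.card + 1)
      (thL (q.2.card : ZMod 2) (Finsupp.single q 1) (Finsupp.single r 1)) := by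
  funext x
  rw [THm_eq, THm_eq]
  exact thL_bracket (single_mem_homog q 1) (single_mem_homog r 1) x

lemma Mcomp_le_HOcomp {p : ℕ} (hp : p.Prime) [CharP F p] (t : Fin n → ℕ) (h : ℕ) :
    Mcomp F p t h ≤ HOcomp F p t h := by
  refine Submodule.span_le.2 ?_
  rintro _ ⟨q, r, hq, hr, hq3, hr3, hh, rfl⟩
  rw [THm_bracket]
  obtain ⟨d, hd⟩ := Nat.exists_eq_add_of_le' (show 1 ≤ (∑ i, q.1 i) + q.2.card by omega)
  obtain ⟨e, he⟩ := Nat.exists_eq_add_of_le' (show 1 ≤ (∑ i, r.1 i) + r.2.card by omega)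
  have h1 := thL_mem_truncIdx (F := F) hp (q.2.card : ZMod 2) (t := t) ⟨hq, hd⟩ ⟨hr, he⟩
  have h2 := thL_mem_homog (single_mem_homog q (1 : F)) (single_mem_homog r (1 : F))
  have h3 := Submodule.mem_inf.2 ⟨h1, h2⟩
  rw [homog, ← Finsupp.supported_inter] at h3
  refine map_mem_of_supported ((LinearMap.ltoFun F _ _ F).comp (thL _)) ?_ h3
  rintro s ⟨hs, hsc⟩
  refine Submodule.subset_span ⟨s, hs.1, hs.2.trans (by omega), ?_⟩
  rw [THm_eq, hsc]
  rfl

lemma THm_mem_Mcomp {p : ℕ} {t : Fin n → ℕ} {h : ℕ} {q r s : SIdx n n}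
    (hq : ∀ i, q.1 i ≤ p ^ t i - 1) (hr : ∀ i, r.1 i ≤ p ^ t i - 1)
    (hq3 : 3 ≤ (∑ i, q.1 i) + q.2.card) (hr3 : 3 ≤ (∑ i, r.1 i) + r.2.card)
    (hh : ((∑ i, q.1 i) + q.2.card - 2) + ((∑ i, r.1 i) + r.2.card - 2) = h) {k : F} (hk : k ≠ 0)
    (hs : (s.2.card : ZMod 2) = q.2.card + r.2.card + 1)
    (hqr : thL (q.2.card : ZMod 2) (Finsupp.single q (1 : F)) (Finsupp.single r 1) =
      k • Finsupp.single s 1) : THm F s ∈ Mcomp F p t h := by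
  have h1 : k • THm F s ∈ Mcomp F p t h := by
    refine Submodule.subset_span ⟨q, r, hq, hr, hq3, hr3, hh, ?_⟩
    rw [THm_bracket, hqr, THm_eq, hs, map_smul]
    rfl
  exact (Submodule.smul_mem_iff _ hk).1 h1

/-! ### Brackets with cubic and quartic monomials -/

lemma single_add_update_sub {j : Fin n} {a : Fin n → ℕ} {k : ℕ} (hk : k ≤ a j) :
    Pi.single j k + Function.update a j (a j - k) = a := by
  ext i
  rcases eq_or_ne i j with rfl | hi
  · simp [hk]
  · simp [hi]

lemma divPowCoeff_single_update {j : Fin n} {a : Fin n → ℕ} {k : ℕ} (hk : k ≤ a j) :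
    divPowCoeff F (Pi.single j k) (Function.update a j (a j - k)) = ((a j).choose k : F) := by
  rw [divPowCoeff_eq j, Finset.prod_eq_one]
  · simp [hk]
  · intro i hi
    simp [Finset.ne_of_mem_erase hi]

lemma thL_single_singleton {j : Fin n} {a : Fin n → ℕ} {u : Finset (Fin n)} {m : ℕ}
    (hm : m + 1 ≤ a j) :
    thL 1 (Finsupp.single (Pi.single j (m + 1), {j}) (1 : F))
      (Finsupp.single (Function.update a j (a j - m), u) 1) =
    ((if j ∈ u then ((a j).choose m : F) else 0) - ((a j).choose (m + 1) : F)) •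
      Finsupp.single (a, u) 1 := by
  rw [thL_apply', Finset.sum_eq_single j]
  · have h1 : Function.update (Pi.single j (m + 1) : Fin n → ℕ) j m = Pi.single j m := by
      simp [Pi.single]
    have h2 : a j - m - 1 = a j - (m + 1) := by omega
    simp only [deL_single, doL_single, Pi.single_eq_same, Function.update_self, Finset.mem_singleton,
      Function.update_idem, if_true, Nat.succ_pos, if_pos (show 0 < a j - m by omega),
      Nat.add_sub_cancel, h1, h2, Finset.erase_singleton, sgn_one]
    rw [mulL_single_of_disjoint (by simp)]
    simp only [single_add_update_sub hm, divPowCoeff_single_update hm]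
    by_cases hj : j ∈ u
    · rw [if_pos hj, if_pos hj, mulL_single_of_disjoint (by simp)]
      simp only [single_add_update_sub (show m ≤ a j by omega),
        divPowCoeff_single_update (show m ≤ a j by omega), ← Finset.insert_eq,
        Finset.insert_erase hj]
      have h3 := mulSign_mul_self (F := F) {j} (u.erase j)
      rw [Finset.empty_union, Finsupp.smul_single, Finsupp.smul_single, ← Finsupp.single_add]
      congr 1
      simp only [mulSign_empty_left, mulSign_empty_right, smul_eq_mul]
      linear_combination ((a j).choose m : F) * h3
    · rw [if_neg hj, if_neg hj]
      simp [mulSign_empty_left, mulSign_empty_right]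
  · intro i _ hi
    simp [deL_single, doL_single, hi]
  · simp

lemma THm_mem_Mcomp_of_choose {p : ℕ} {t : Fin n → ℕ} {h : ℕ} {a : Fin n → ℕ}
    {u : Finset (Fin n)} {j : Fin n} {m : ℕ} (ha : ∀ i, a i ≤ p ^ t i - 1)
    (hd : (∑ i, a i) + u.card = h + 2) (hm : m + 1 ≤ a j) (hm1 : 1 ≤ m) (hmh : m + 1 ≤ h)
    (hk : (if j ∈ u then ((a j).choose m : F) else 0) - ((a j).choose (m + 1) : F) ≠ 0) :
    THm F (a, u) ∈ Mcomp F p t h := by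
  have hs : m + ∑ i, Function.update a j (a j - m) i = ∑ i, a i := by
    have := congrArg (fun f => ∑ i, f i) (single_add_update_sub (show m ≤ a j by omega))
    simpa [Finset.sum_add_distrib] using this
  refine THm_mem_Mcomp (q := (Pi.single j (m + 1), {j})) (r := (Function.update a j (a j - m), u))
    (fun i => ?_) (fun i => ?_) ?_ ?_ ?_ hk ?_ ?_
  · rcases eq_or_ne i j with rfl | hi
    · simpa using hm.trans (ha i)
    · simp [hi]
  · rcases eq_or_ne i j with rfl | hi
    · simpa using (Nat.sub_le _ _).trans (ha i)
    · simpa [hi] using ha i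
  · simp; omega
  · dsimp only; omega
  · simp; omega
  · rw [Finset.card_singleton, Nat.cast_one, add_right_comm, one_add_one_zmod, zero_add]
  · rw [Finset.card_singleton, Nat.cast_one, thL_single_singleton hm]

lemma two_mul_cast_choose_two (a : ℕ) : 2 * (a.choose 2 : F) = a * (a - 1) := by
  cases a with
  | zero => simp
  | succ a =>
    have := congrArg (Nat.cast (R := F)) (Nat.add_one_mul_choose_eq a 1)
    push_cast [Nat.choose_one_right] at this ⊢
    linear_combination -this

lemma three_mul_cast_choose_three (a : ℕ) :
    3 * (a.choose 3 : F) = (a - 2) * a.choose 2 := by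
  have := congrArg (Nat.cast (R := F)) (Nat.choose_succ_right_eq a 2)
  rcases lt_or_ge a 2 with h | h
  · simp [Nat.choose_eq_zero_of_lt h, Nat.choose_eq_zero_of_lt (h.trans (by norm_num : 2 < 3))]
  · push_cast [Nat.cast_sub h] at this
    linear_combination this

lemma THm_mem_Mcomp_of_mod {p : ℕ} (hp : p.Prime) (hp3 : 3 < p) [CharP F p] {t : Fin n → ℕ}
    {h : ℕ} (hh : 3 ≤ h) {q : SIdx n n} (hq : ∀ i, q.1 i ≤ p ^ t i - 1)
    (hd : (∑ i, q.1 i) + q.2.card = h + 2) {j : Fin n} (h0 : q.1 j % p ≠ 0) (h1 : q.1 j % p ≠ 1) :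
    THm F q ∈ Mcomp F p t h := by
  obtain ⟨a, u⟩ := q
  dsimp only at hq hd h0 h1
  have hcast {k : ℕ} (hk : 0 < k) (hkp : k < p) : (k : F) ≠ 0 := fun h =>
    absurd (Nat.le_of_dvd hk ((CharP.cast_eq_zero_iff F p k).1 h)) (by omega)
  have c2 : (2 : F) ≠ 0 := by exact_mod_cast hcast (k := 2) (by omega) (by omega)
  have c3 : (3 : F) ≠ 0 := by exact_mod_cast hcast (k := 3) (by omega) (by omega)
  have ha2 : 2 ≤ a j := by
    by_contra hlt
    rcases (show a j = 0 ∨ a j = 1 by omega) with h | h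
    · simp [h] at h0
    · rw [h, Nat.mod_eq_of_lt hp.one_lt] at h1
      exact h1 rfl
  have ca0 : (a j : F) ≠ 0 := fun h =>
    h0 (Nat.mod_eq_zero_of_dvd ((CharP.cast_eq_zero_iff F p _).1 h))
  have ca1 : (a j : F) - 1 ≠ 0 := fun h => by
    have h2 : ((a j - 1 : ℕ) : F) = 0 := by rw [Nat.cast_sub (by omega), Nat.cast_one, h]
    obtain ⟨k, hk⟩ := (CharP.cast_eq_zero_iff F p _).1 h2
    have : a j = 1 + p * k := by omega
    rw [this, Nat.add_mul_mod_self_left, Nat.mod_eq_of_lt hp.one_lt] at h1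
    exact h1 rfl
  have hc2 := two_mul_cast_choose_two (F := F) (a j)
  have hc3 := three_mul_cast_choose_three (F := F) (a j)
  by_cases hj : j ∈ u
  · by_cases h3 : (a j : F) = 3
    · have ha3 : 3 ≤ a j := by
        by_contra hlt
        rw [show a j = 2 by omega] at h3
        exact one_ne_zero (α := F) (by push_cast at h3; linear_combination -h3)
      refine THm_mem_Mcomp_of_choose (m := 2) hq hd ha3 (by omega) hh fun h => ?_
      rw [if_pos hj] at h
      rw [h3] at hc2 hc3
      have : (2 : F) * 2 * 3 = 0 := by linear_combination 6 * h - 2 * hc2 + 2 * hc3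
      simp [c2, c3] at this
    · refine THm_mem_Mcomp_of_choose (m := 1) hq hd ha2 le_rfl (by omega) fun h => ?_
      rw [if_pos hj, Nat.choose_one_right] at h
      have : (a j : F) * (3 - a j) = 0 := by linear_combination 2 * h + hc2
      rcases mul_eq_zero.1 this with h | h
      · exact ca0 h
      · exact h3 (sub_eq_zero.1 h).symm
  · refine THm_mem_Mcomp_of_choose (m := 1) hq hd ha2 le_rfl (by omega) fun h => ?_
    rw [if_neg hj] at h
    have : (a j : F) * (a j - 1) = 0 := by linear_combination -2 * h - hc2
    rcases mul_eq_zero.1 this with h | h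
    · exact ca0 h
    · exact ca1 h

variable (F)

/-- For `h ≥ 3`:
`HO_h = M(HO)_h + Σ 𝔽·T_H(x^(α)x^u)`, the sum over `|α| + |u| - 2 = h` with
`α_i ≡ 0` or `1 (mod p)` for every `i`. -/
theorem stmt17 (p : ℕ) (hp : p.Prime) (hp3 : 3 < p) [CharP F p]
    (t : Fin n → ℕ) (ht : ∀ i, 0 < t i) (h : ℕ) (hh : 3 ≤ h) :
    HOcomp F p t h = Mcomp F p t h ⊔ Acomp F p t h := by
  refine le_antisymm (Submodule.span_le.2 ?_) (sup_le (Mcomp_le_HOcomp hp t h) ?_)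
  · rintro _ ⟨q, hq, hd, rfl⟩
    by_cases hA : ∀ i, q.1 i % p = 0 ∨ q.1 i % p = 1
    · exact Submodule.mem_sup_right (Submodule.subset_span ⟨q, hq, hd, hA, rfl⟩)
    · push Not at hA
      obtain ⟨j, h0, h1⟩ := hA
      exact Submodule.mem_sup_left (THm_mem_Mcomp_of_mod hp hp3 hh hq hd h0 h1)
  · refine Submodule.span_mono ?_
    rintro _ ⟨q, hq, hd, -, rfl⟩
    exact ⟨q, hq, hd, rfl⟩

end
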